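/- arXiv:1904.13360 — 2 statements merged into one kernel-verified Lean document; each statement's English description precedes it below -/
import Mathlib

section
/- For the POMDP Γ_ex with initial state k₀ (initial belief δ_{k₀}), every strategy σ with finite recall satisfies γ^{δ_{k₀}}_∞(σ) ≤ 1/2; in particular, since v_∞(δ_{k₀}) = 5/6, finite-recall strategies are not ε-optimal for ε < 1/3. -/
open MeasureTheory Filter

namespace PomdpPaper

/-- A belief (probability vector) on `Fin n`. -/
def IsBelief {n : ℕ} (p : Fin n → ℝ) : Prop :=
  (∀ k, 0 ≤ p k) ∧ ∑ k, p k = 1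

/-- The measure on a finite type associated with a probability vector. -/
noncomputable def vecMeasure {α : Type*} [Fintype α] [MeasurableSpace α] (p : α → ℝ) :
    Measure α :=
  ∑ x : α, ENNReal.ofReal (p x) • Measure.dirac x

/-- The Dirac belief at a point. -/
def diracBelief {n : ℕ} (k : Fin n) : Fin n → ℝ := fun k' => if k' = k then 1 else 0

/-- The `i`-th binary digit of a real number `x ∈ [0,1)` (as a real number `0` or `1`). -/
noncomputable def digitR (x : ℝ) (i : ℕ) : ℝ :=
  if ⌊x * 2 ^ (i + 1)⌋ % 2 = 1 then 1 else 0

/-- From one uniform seed `x ∈ [0,1)`, a sequence `unif x 0, unif x 1, …` of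
(independent, uniformly distributed on `[0,1]`) real numbers, obtained by splitting the
binary digits of `x` along the pairing function. -/
noncomputable def unif (x : ℝ) (m : ℕ) : ℝ :=
  ∑' j : ℕ, digitR x (Nat.pair m j) / 2 ^ (j + 1)

open Classical in
/-- Inverse-transform sampling from a probability vector on `Fin n` using a seed `u ∈ [0,1]`. -/
noncomputable def sampleFin {n : ℕ} (hn : 0 < n) (p : Fin n → ℝ) (u : ℝ) : Fin n :=
  let s : Finset (Fin n) :=
    Finset.univ.filter fun y : Fin n => u < ∑ z ∈ Finset.univ.filter fun z : Fin n => z ≤ y, p z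
  if hs : s.Nonempty then s.min' hs else ⟨0, hn⟩

/-- Inverse-transform sampling from a probability vector on a finite nonempty type. -/
noncomputable def sampleOn {β : Type*} [Fintype β] [Nonempty β] (p : β → ℝ) (u : ℝ) : β :=
  (Fintype.equivFin β).symm
    (sampleFin Fintype.card_pos (fun i => p ((Fintype.equivFin β).symm i)) u)

/-- A POMDP with states `Fin nK`, actions `Fin nA`, signals `Fin nS`, transition function `q`
and reward function `g` with values in `[0,1]`. -/
structure POMDP where
  nK : ℕ
  nA : ℕ
  nS : ℕ
  hK : 0 < nK
  hA : 0 < nA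
  hS : 0 < nS
  q : Fin nK → Fin nA → Fin nK × Fin nS → ℝ
  q_nonneg : ∀ k a y, 0 ≤ q k a y
  q_sum : ∀ k a, ∑ y, q k a y = 1
  g : Fin nK → Fin nA → ℝ
  g_nonneg : ∀ k a, 0 ≤ g k a
  g_le_one : ∀ k a, g k a ≤ 1

namespace POMDP

variable (Γ : POMDP)

/-- The state space. -/
abbrev K := Fin Γ.nK
/-- The action space. -/
abbrev A := Fin Γ.nA
/-- The signal space. -/
abbrev S := Fin Γ.nS

instance : Nonempty Γ.K := ⟨⟨0, Γ.hK⟩⟩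
instance : Nonempty Γ.A := ⟨⟨0, Γ.hA⟩⟩
instance : Nonempty Γ.S := ⟨⟨0, Γ.hS⟩⟩

/-- A history: the finite sequence of past actions and signals. -/
abbrev Hist := List (Γ.A × Γ.S)

/-- A (pure) strategy: a map from histories to actions. -/
abbrev Strategy := Γ.Hist → Γ.A

/-- The sample space carrying all the randomness: an initial state together with a
uniform seed in `[0,1)` used to draw all the transitions. -/
abbrev Env := Γ.K × ℝ

/-- The probability measure on the sample space induced by the initial belief `p1`:
the initial state is drawn according to `p1`, the seed uniformly on `[0,1)`. -/
noncomputable def envMeasure (p1 : Γ.K → ℝ) : Measure Γ.Env :=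
  (vecMeasure p1).prod (volume.restrict (Set.Ico (0 : ℝ) 1))

/-- The trajectory: `(Γ.traj σ ω m).1` is the state `k_{m+1}` at stage `m+1` and
`(Γ.traj σ ω m).2` is the history before stage `m+1` (of length `m`), when the
decision-maker uses strategy `σ` and the randomness is `ω`.  At each stage, the pair
(new state, signal) is drawn from `q` via inverse-transform sampling from a fresh
uniform variable. -/
noncomputable def traj (σ : Γ.Strategy) (ω : Γ.Env) : ℕ → Γ.K × Γ.Hist
  | 0 => (ω.1, [])
  | m + 1 =>
    let p := traj σ ω m
    let a := σ p.2
    let y := sampleOn (Γ.q p.1 a) (unif ω.2 m)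
    (y.1, p.2 ++ [(a, y.2)])

/-- The state `k_{m+1}` at stage `m+1` (`m` is 0-indexed). -/
noncomputable def state (σ : Γ.Strategy) (ω : Γ.Env) (m : ℕ) : Γ.K := (Γ.traj σ ω m).1

/-- The history before stage `m+1` (a list of length `m`). -/
noncomputable def hist (σ : Γ.Strategy) (ω : Γ.Env) (m : ℕ) : Γ.Hist := (Γ.traj σ ω m).2

/-- The action `a_{m+1}` played at stage `m+1`. -/
noncomputable def act (σ : Γ.Strategy) (ω : Γ.Env) (m : ℕ) : Γ.A := σ (Γ.hist σ ω m)

/-- The reward `g_{m+1}` obtained at stage `m+1`. -/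
noncomputable def rew (σ : Γ.Strategy) (ω : Γ.Env) (m : ℕ) : ℝ :=
  Γ.g (Γ.state σ ω m) (Γ.act σ ω m)

/-- The average reward over the first `n` stages. -/
noncomputable def avg (σ : Γ.Strategy) (ω : Γ.Env) (n : ℕ) : ℝ :=
  (1 / n : ℝ) * ∑ m ∈ Finset.range n, Γ.rew σ ω m

/-- The probability of an event under initial belief `p1` (the strategy `σ` is recorded for
readability; the underlying measure does not depend on it). -/
noncomputable def prob (p1 : Γ.K → ℝ) (_σ : Γ.Strategy) (E : Set Γ.Env) : ℝ :=
  (Γ.envMeasure p1 E).toReal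

/-- The long-run average payoff `γ^{p1}_∞(σ) = E[liminf (1/n) ∑ g_m]`. -/
noncomputable def pay (p1 : Γ.K → ℝ) (σ : Γ.Strategy) : ℝ :=
  ∫ ω, atTop.liminf (Γ.avg σ ω) ∂(Γ.envMeasure p1)

/-- The payoff starting from a deterministic state `k`, i.e. `γ^k_∞(σ)`. -/
noncomputable def payK (k : Γ.K) (σ : Γ.Strategy) : ℝ := Γ.pay (diracBelief k) σ

/-- The value `v_∞(p1)`. -/
noncomputable def val (p1 : Γ.K → ℝ) : ℝ := ⨆ σ : Γ.Strategy, Γ.pay p1 σ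

/-- A strategy has finite memory if it is implemented by a finite-state transducer. -/
def FiniteMemory (σ : Γ.Strategy) : Prop :=
  ∃ (n : ℕ) (m0 : Fin n) (σa : Fin n → Γ.A) (σu : Fin n → Γ.A × Γ.S → Fin n),
    ∀ h : Γ.Hist, σ h = σa (h.foldl σu m0)

/-- A blind MDP: the signal set is a singleton. -/
def Blind : Prop := Γ.nS = 1

/-- The strategy induced by a sequence of actions `a_1, a_2, …` (`as m` is the action played
at stage `m+1`, regardless of the observed history). -/
def blindStrat (as : ℕ → Γ.A) : Γ.Strategy := fun h => as h.length

end POMDP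

/-- A sequence is eventually periodic if it is periodic with some period `T ≥ 1` from
some stage `N` on. -/
def EventuallyPeriodic {α : Type*} (as : ℕ → α) : Prop :=
  ∃ T ≥ 1, ∃ N ≥ 1, ∀ m ≥ N, as (m + T) = as m


/-- The transition function of the example POMDP `Γex` (states `k₀,…,k₄ = 0,…,4`, actions
`a = 0`, `b = 1`, signals `s_a = 0`, `s_b = 1`). -/
noncomputable def qex : Fin 5 → Fin 2 → Fin 5 × Fin 2 → ℝ := fun k act y =>
  if k = 0 then (if y = (1, 1) then 1 / 2 else if y = (3, 0) then 1 / 2 else 0)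
  else if k = 1 then
    (if act = 0 then (if y = (1, 0) then 1 / 2 else if y = (2, 1) then 1 / 2 else 0)
     else (if y = (4, 0) then 1 else 0))
  else if k = 2 then
    (if act = 0 then (if y = (4, 0) then 1 else 0)
     else (if y = (1, 0) then 1 else 0))
  else if k = 3 then
    (if act = 0 then (if y = (3, 0) then 1 / 2 else if y = (3, 1) then 1 / 2 else 0)
     else (if y = (4, 0) then 1 else 0))
  else (if y = (4, 0) then 1 else 0)

/-- The reward function of `Γex`: reward `1` in states `k₁` and `k₃`, and `0` otherwise. -/
noncomputable def gex : Fin 5 → Fin 2 → ℝ := fun k _ =>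
  if k = 1 ∨ k = 3 then 1 else 0

/-- The example POMDP of Remark 5 of the paper. -/
noncomputable def Γex : POMDP where
  nK := 5
  nA := 2
  nS := 2
  hK := by norm_num
  hA := by norm_num
  hS := by norm_num
  q := qex
  q_nonneg := by
    intro k a y
    simp only [qex]
    split_ifs <;> norm_num
  q_sum := by
    intro k a
    fin_cases k <;> fin_cases a <;>
      simp [qex, Fintype.sum_prod_type, Fin.sum_univ_five, Fin.sum_univ_two,
        Prod.ext_iff] <;>
      norm_num <;> decide
  g := gex
  g_nonneg := by
    intro k a
    simp only [gex]
    split_ifs <;> norm_num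
  g_le_one := by
    intro k a
    simp only [gex]
    split_ifs <;> norm_num

/-- A strategy has finite recall if there is `M ≥ 1` such that after every history of
length at least `M`, the action only depends on the length of the history and on its last
`M` action–signal pairs. -/
def POMDP.FiniteRecall (Γ : POMDP) (σ : Γ.Strategy) : Prop :=
  ∃ M ≥ 1, ∀ h h' t : Γ.Hist, h.length = h'.length → t.length = M →
    σ (h ++ t) = σ (h' ++ t)

/-- `A` depends only on the first `n` bits. -/
def Dep {Ω : Type*} (B : ℕ → Ω → Bool) (n : ℕ) (A : Set Ω) : Prop :=
  ∀ x y, (∀ j < n, B j x = B j y) → x ∈ A → y ∈ A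

/-- A sequence of independent fair bits. -/
structure FairBits {Ω : Type*} [MeasurableSpace Ω] (μ : Measure Ω) (B : ℕ → Ω → Bool) : Prop where
  meas : ∀ n, Measurable (B n)
  half : ∀ n A v, Dep B n A → μ (A ∩ {x | B n x = v}) = μ A / 2

section Bits
variable {Ω : Type*} [MeasurableSpace Ω] {μ : Measure Ω} {B : ℕ → Ω → Bool}

lemma Dep.mono {n m : ℕ} {A : Set Ω} (h : Dep B n A) (hnm : n ≤ m) : Dep B m A :=
  fun x y hxy hx => h x y (fun j hj => hxy j (by omega)) hx

lemma Dep.inter {n : ℕ} {A A' : Set Ω} (h : Dep B n A) (h' : Dep B n A') : Dep B n (A ∩ A') :=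
  fun x y hxy hx => ⟨h x y hxy hx.1, h' x y hxy hx.2⟩

lemma FairBits.measDep (hB : FairBits μ B) {n : ℕ} {A : Set Ω} (h : Dep B n A) :
    MeasurableSet A := by
  have hm : Measurable (fun x (j : Fin n) => B j x) := measurable_pi_lambda _ fun j => hB.meas j
  have : A = (fun x (j : Fin n) => B j x) ⁻¹' ((fun x (j : Fin n) => B j x) '' A) := by
    ext y
    constructor
    · exact fun hy => ⟨y, hy, rfl⟩
    · rintro ⟨x, hx, hxy⟩
      exact h x y (fun j hj => congrFun hxy ⟨j, hj⟩) hx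
  rw [this]
  exact hm (Set.toFinite _).measurableSet

lemma FairBits.comp (hB : FairBits μ B) {f : ℕ → ℕ} (hf : StrictMono f) :
    FairBits μ (fun n => B (f n)) where
  meas n := hB.meas _
  half n A v h := hB.half (f n) A v
    fun x y hxy hx => h x y (fun j hj => hxy (f j) (hf hj)) hx

lemma FairBits.halfEq (hB : FairBits μ B) {n : ℕ} {A : Set Ω} (hA : Dep B n A)
    {h : Ω → Bool} (hh : ∀ v, Dep B n {x | h x = v}) :
    μ (A ∩ {x | B n x = h x}) = μ A / 2 := by
  have m1 : MeasurableSet {x | h x = true} := hB.measDep (hh true)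
  have m2 : MeasurableSet {x | B n x = true} := hB.meas n (measurableSet_singleton true)
  rw [← measure_inter_add_sdiff (A ∩ {x | B n x = h x}) m2]
  have e1 : (A ∩ {x | B n x = h x}) ∩ {x | B n x = true}
      = (A ∩ {x | h x = true}) ∩ {x | B n x = true} := by
    ext x; simp only [Set.mem_inter_iff, Set.mem_ofPred_eq]; grind
  have e2 : (A ∩ {x | B n x = h x}) \ {x | B n x = true}
      = (A ∩ {x | h x = false}) ∩ {x | B n x = false} := by
    ext x; simp only [Set.mem_inter_iff, Set.mem_sdiff, Set.mem_ofPred_eq]; grind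
  rw [e1, e2, hB.half _ _ _ (hA.inter (hh true)), hB.half _ _ _ (hA.inter (hh false)),
    ← measure_inter_add_sdiff A m1, ENNReal.div_add_div_same]
  congr 3
  ext x; simp

lemma FairBits.word (hB : FairBits μ B) (w : ℕ → Bool) (L : ℕ) {n : ℕ} {A : Set Ω}
    (hA : Dep B n A) :
    Dep B (n + L) (A ∩ {x | ∀ i < L, B (n + i) x = w i}) ∧
    μ (A ∩ {x | ∀ i < L, B (n + i) x = w i}) = μ A * (2⁻¹) ^ L := by
  induction L with
  | zero => simpa using hA
  | succ L ih =>
    obtain ⟨h1, h2⟩ := ih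
    have e : A ∩ {x | ∀ i < L + 1, B (n + i) x = w i}
        = (A ∩ {x | ∀ i < L, B (n + i) x = w i}) ∩ {x | B (n + L) x = w L} := by
      ext x
      simp only [Set.mem_inter_iff, Set.mem_ofPred_eq, Nat.lt_succ_iff_lt_or_eq, or_imp,
        forall_and, forall_eq, and_assoc]
    rw [e]
    constructor
    · rintro x y hxy ⟨hx, hx'⟩
      exact ⟨h1 x y (fun j hj => hxy j (by omega)) hx, by
        simpa [← hxy (n + L) (by omega)] using hx'⟩
    · rw [hB.half _ _ _ h1, h2, pow_succ, ← mul_assoc, ENNReal.div_eq_inv_mul, mul_comm]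

lemma FairBits.aeWord [IsProbabilityMeasure μ] (hB : FairBits μ B) (w : ℕ → Bool) (L : ℕ)
    (T : Set ℕ) (hT : T.Infinite) :
    ∀ᵐ x ∂μ, ∃ t ∈ T, ∀ i < L, B (t + i) x = w i := by
  have key : ∀ k : ℕ, ∃ n, ∃ A : Set Ω, Dep B n A ∧
      {x | ¬ ∃ t ∈ T, ∀ i < L, B (t + i) x = w i} ⊆ A ∧ μ A ≤ (1 - (2⁻¹) ^ L) ^ k := by
    intro k
    induction k with
    | zero => exact ⟨0, Set.univ, fun _ _ _ _ => trivial, Set.subset_univ _, by simp⟩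
    | succ k ih =>
      obtain ⟨n, A, hA, hsub, hm⟩ := ih
      obtain ⟨t, htT, hnt⟩ := hT.exists_gt n
      have hA' := hA.mono hnt.le
      obtain ⟨h1, h2⟩ := hB.word w L hA'
      refine ⟨t + L, A \ (A ∩ {x | ∀ i < L, B (t + i) x = w i}), ?_, ?_, ?_⟩
      · rintro x y hxy ⟨hx, hx'⟩
        refine ⟨hA' x y (fun j hj => hxy j (by omega)) hx, fun hy => hx' ?_⟩
        exact h1 y x (fun j hj => (hxy j hj).symm) hy
      · intro x hx
        refine ⟨hsub hx, fun h => hx ⟨t, htT, h.2⟩⟩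
      · rw [measure_sdiff Set.inter_subset_left (hB.measDep h1).nullMeasurableSet
          (measure_ne_top _ _), h2]
        calc μ A - μ A * 2⁻¹ ^ L = μ A * (1 - 2⁻¹ ^ L) := by
              rw [ENNReal.mul_sub (fun _ _ => measure_ne_top _ _), mul_one]
          _ ≤ (1 - (2⁻¹) ^ L) ^ k * (1 - 2⁻¹ ^ L) := by gcongr
          _ = _ := (pow_succ _ _).symm
  rw [ae_iff]
  have hlim : Tendsto (fun k : ℕ => (1 - (2⁻¹ : ENNReal) ^ L) ^ k) atTop (nhds 0) := by
    apply ENNReal.tendsto_pow_atTop_nhds_zero_of_lt_one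
    apply ENNReal.sub_lt_self (by simp) (by simp) (by simp)
  refine le_antisymm (ge_of_tendsto' hlim fun k => ?_) (zero_le)
  obtain ⟨n, A, -, hsub, hm⟩ := key k
  exact (measure_mono hsub).trans hm

lemma FairBits.slln [IsProbabilityMeasure μ] (hB : FairBits μ B) (h : ℕ → Ω → Bool)
    (hh : ∀ n v, Dep B n {x | h n x = v}) :
    ∀ᵐ x ∂μ, Tendsto (fun n : ℕ =>
      (∑ i ∈ Finset.range n, if B i x = h i x then (1 : ℝ) else 0) / n) atTop (nhds (1 / 2)) := by
  set V : ℕ → Set Ω := fun i => {x | B i x = h i x} with hV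
  have hVD : ∀ i, Dep B (i + 1) (V i) := by
    intro i x y hxy hx
    have h1 := hh i (h i x) x y (fun j hj => hxy j (by omega)) rfl
    simp only [hV, Set.mem_ofPred_eq] at hx h1 ⊢
    rw [h1, ← hx, hxy i (by omega)]
  have hVm : ∀ i, MeasurableSet (V i) := fun i => hB.measDep (hVD i)
  have hprod : ∀ s : Finset ℕ, μ (⋂ i ∈ s, V i) = (2⁻¹) ^ s.card := by
    intro s
    induction s using Finset.induction_on_max with
    | empty => simp
    | insert a s hs ih =>
      have ha : a ∉ s := fun h => lt_irrefl _ (hs a h)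
      have hd : Dep B a (⋂ i ∈ s, V i) := by
        intro x y hxy hx
        simp only [Set.mem_iInter] at hx ⊢
        exact fun i hi => (hVD i).mono (hs i hi) x y hxy (hx i hi)
      rw [Finset.set_biInter_insert, Set.inter_comm, hB.halfEq hd (hh a), ih,
        Finset.card_insert_of_notMem ha, pow_succ, ENNReal.div_eq_inv_mul, mul_comm]
  have hV1 : ∀ i, μ (V i) = 2⁻¹ := by
    intro i; simpa using hprod {i}
  have hind : ProbabilityTheory.iIndepSet V μ := by
    rw [ProbabilityTheory.iIndepSet_iff_meas_biInter hVm]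
    intro s
    rw [hprod s]; simp [hV1]
  have hif := hind.iIndepFun_indicator (β := ℝ) (m := inferInstance)
  have hsl := ProbabilityTheory.strong_law_ae_real (μ := μ)
    (fun n => (V n).indicator fun _ => (1 : ℝ))
    ((integrable_const 1).indicator (hVm 0)) (fun i j hij => hif.indepFun hij) ?_
  · filter_upwards [hsl] with x hx
    have : ∫ x, (V 0).indicator (fun _ => (1 : ℝ)) x ∂μ = 1 / 2 := by
      rw [integral_indicator_const _ (hVm 0)]
      simp [Measure.real, hV1]
    simp only [this] at hx
    simpa [Set.indicator, hV] using hx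
  · intro i
    have hmi : ∀ i, Measurable ((V i).indicator fun _ => (1 : ℝ)) :=
      fun i => measurable_const.indicator (hVm i)
    refine ⟨(hmi i).aemeasurable, (hmi 0).aemeasurable, ?_⟩
    ext S hS
    rw [Measure.map_apply (hmi i) hS, Measure.map_apply (hmi 0) hS]
    have hc : ∀ i, μ (V i)ᶜ = 2⁻¹ := fun i => by
      rw [measure_compl (hVm i) (measure_ne_top _ _), hV1]; simp
    classical
    rw [Set.indicator_const_preimage_eq_union, Set.indicator_const_preimage_eq_union]
    by_cases h1 : (1 : ℝ) ∈ S <;> by_cases h0 : (0 : ℝ) ∈ S <;>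
      simp [h1, h0, hV1, hc]

end Bits

/-- binary digits as Booleans -/
noncomputable def dig (i : ℕ) (x : ℝ) : Bool := decide (⌊x * 2 ^ (i + 1)⌋ % 2 = 1)

lemma floor_dig (x : ℝ) {i j : ℕ} (hij : j ≤ i) :
    ⌊x * 2 ^ (j + 1)⌋ = ⌊x * 2 ^ (i + 1)⌋ / 2 ^ (i - j) := by
  have h := Int.floor_div_natCast (x * 2 ^ (i + 1)) (2 ^ (i - j))
  push_cast at h
  rw [← h]
  congr 1
  obtain ⟨k, rfl⟩ := Nat.exists_eq_add_of_le hij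
  rw [show j + k - j = k by omega, show j + k + 1 = (j + 1) + k by ring, pow_add _ (j + 1) k, ← mul_assoc,
    mul_div_cancel_right₀ _ (by positivity)]

lemma fair_dig : FairBits (volume.restrict (Set.Ico (0 : ℝ) 1)) dig where
  meas n := by
    have h : Measurable fun x : ℝ => ⌊x * 2 ^ (n + 1)⌋ :=
      Int.measurable_floor.comp (measurable_id.mul_const _)
    exact (Measurable.of_discrete (f := fun z : ℤ => decide (z % 2 = 1))).comp h
  half n A v hA := by
    have hmeas : ∀ v, MeasurableSet {x | dig n x = v} := by
      intro v
      have : Measurable (dig n) := by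
        have h : Measurable fun x : ℝ => ⌊x * 2 ^ (n + 1)⌋ :=
          Int.measurable_floor.comp (measurable_id.mul_const _)
        exact (Measurable.of_discrete (f := fun z : ℤ => decide (z % 2 = 1))).comp h
      exact this (measurableSet_singleton v)
    set μ := volume.restrict (Set.Ico (0 : ℝ) 1) with hμ
    have key : μ (A ∩ {x | dig n x = false}) = μ (A ∩ {x | dig n x = true}) := by
      rw [hμ, Measure.restrict_apply' measurableSet_Ico, Measure.restrict_apply' measurableSet_Ico]
      rw [← measure_preimage_add_right volume ((1 : ℝ) / 2 ^ (n + 1))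
        (A ∩ {x | dig n x = true} ∩ Set.Ico 0 1)]
      congr 1
      ext x
      set y := x + 1 / 2 ^ (n + 1) with hy
      have hp : (0 : ℝ) < 2 ^ (n + 1) := by positivity
      have hfl : ⌊y * 2 ^ (n + 1)⌋ = ⌊x * 2 ^ (n + 1)⌋ + 1 := by
        rw [hy, add_mul, one_div_mul_cancel hp.ne', Int.floor_add_one]
      have hico : ∀ z : ℝ, z ∈ Set.Ico (0 : ℝ) 1 ↔
          0 ≤ ⌊z * 2 ^ (n + 1)⌋ ∧ ⌊z * 2 ^ (n + 1)⌋ < 2 ^ (n + 1) := by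
        intro z
        rw [Int.le_floor, Int.floor_lt, Set.mem_Ico]
        push_cast
        constructor
        · rintro ⟨a, b⟩; constructor <;> nlinarith
        · rintro ⟨a, b⟩; constructor <;> by_contra! h <;> nlinarith
      have hd : dig n y = !dig n x := by
        simp only [dig, hfl]; grind
      simp only [Set.mem_inter_iff, Set.mem_preimage, Set.mem_ofPred_eq, ← hy, hd]
      by_cases hx : dig n x = false
      · have hN : ⌊x * 2 ^ (n + 1)⌋ % 2 = 0 := by
          simp only [dig, decide_eq_false_iff_not] at hx; omega
        have hag : ∀ j < n, dig j x = dig j y := by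
          intro j hj
          simp only [dig]
          rw [floor_dig x hj.le, floor_dig y hj.le, hfl]
          obtain ⟨k, hk⟩ : ∃ k, n - j = k + 1 := ⟨n - j - 1, by omega⟩
          generalize ⌊x * 2 ^ (n + 1)⌋ = N at hN
          rw [hk, pow_succ', ← Int.ediv_ediv_of_nonneg (by norm_num),
            ← Int.ediv_ediv_of_nonneg (by norm_num)]
          congr 4
          omega
        have hA' : x ∈ A ↔ y ∈ A := ⟨hA x y hag, hA y x fun j hj => (hag j hj).symm⟩
        have hI : x ∈ Set.Ico (0 : ℝ) 1 ↔ y ∈ Set.Ico (0 : ℝ) 1 := by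
          rw [hico, hico, hfl]
          generalize ⌊x * 2 ^ (n + 1)⌋ = N at hN
          rw [pow_succ]
          omega
        rw [hA', hI]; simp [hx]
      · simp [hx]
    have hsum : μ A = μ (A ∩ {x | dig n x = false}) + μ (A ∩ {x | dig n x = true}) := by
      rw [← measure_inter_add_sdiff A (hmeas false)]
      congr 2
      ext x; simp
    rw [hsum]
    cases v
    · rw [← key, ENNReal.add_div, ENNReal.add_halves]
    · rw [key, ENNReal.add_div, ENNReal.add_halves]

/-- the bit deciding transition `m` -/
noncomputable def bit (m : ℕ) (x : ℝ) : Bool := dig (Nat.pair m 0) x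

/-- the good seeds -/
def Good (x : ℝ) : Prop := ∀ m, 0 ≤ unif x m ∧ unif x m < 1 ∧ (unif x m < 1 / 2 ↔ bit m x = false)

instance : IsProbabilityMeasure (volume.restrict (Set.Ico (0 : ℝ) 1)) := ⟨by simp⟩

lemma fair_bit : FairBits (volume.restrict (Set.Ico (0 : ℝ) 1)) bit :=
  fair_dig.comp (f := fun m => Nat.pair m 0) fun _ _ h => Nat.pair_lt_pair_left 0 h

lemma ae_good : ∀ᵐ x ∂(volume.restrict (Set.Ico (0 : ℝ) 1)), Good x := by
  rw [show (fun x => Good x) = fun x => ∀ m, _ from rfl]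
  rw [ae_all_iff]
  intro m
  have hw := (fair_dig.comp (f := fun j => Nat.pair m (j + 1))
    fun _ _ h => Nat.pair_lt_pair_right m (by omega)).aeWord (fun _ => false) 1 Set.univ
    Set.infinite_univ
  filter_upwards [hw] with x hx
  obtain ⟨t, -, ht⟩ := hx
  have ht : dig (Nat.pair m (t + 1)) x = false := ht 0 (by norm_num)
  have h01 : ∀ i, 0 ≤ digitR x i ∧ digitR x i ≤ 1 := by
    intro i; unfold digitR; split_ifs <;> norm_num
  have hgs : HasSum (fun j : ℕ => (1 : ℝ) / 2 ^ (j + 1)) 1 := by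
    have := hasSum_geometric_two' 1
    convert this using 2
    rw [pow_succ]; field_simp
  have hs : Summable fun j : ℕ => digitR x (Nat.pair m j) / 2 ^ (j + 1) := by
    refine Summable.of_nonneg_of_le (fun j => div_nonneg (h01 _).1 (by positivity))
      (fun j => ?_) hgs.summable
    gcongr
    exact (h01 _).2
  have hg2 : HasSum (fun j : ℕ => (1 : ℝ) / 2 ^ (j + 1 + 1)) (1 / 2) := by
    have e : (fun j : ℕ => (1 : ℝ) / 2 ^ (j + 1 + 1)) = fun j : ℕ => (1 : ℝ) / 2 ^ (j + 1) / 2 := by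
      funext j
      rw [pow_succ _ (j + 1), div_div]
    rw [e]
    exact hgs.div_const 2
  have hs2 : Summable fun j : ℕ => digitR x (Nat.pair m (j + 1)) / 2 ^ (j + 1 + 1) :=
    (summable_nat_add_iff 1).2 hs
  have hu : unif x m = digitR x (Nat.pair m 0) / 2
      + ∑' j : ℕ, digitR x (Nat.pair m (j + 1)) / 2 ^ (j + 1 + 1) := by
    unfold unif
    rw [hs.tsum_eq_zero_add]; simp
  have ht0 : 0 ≤ ∑' j : ℕ, digitR x (Nat.pair m (j + 1)) / 2 ^ (j + 1 + 1) :=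
    tsum_nonneg fun j => div_nonneg (h01 _).1 (by positivity)
  have ht1 : ∑' j : ℕ, digitR x (Nat.pair m (j + 1)) / 2 ^ (j + 1 + 1) < 1 / 2 := by
    rw [← hg2.tsum_eq]
    refine Summable.tsum_lt_tsum (i := t) (fun j => ?_) ?_ hs2 hg2.summable
    · show digitR x (Nat.pair m (j + 1)) / 2 ^ (j + 1 + 1) ≤ 1 / 2 ^ (j + 1 + 1)
      gcongr
      exact (h01 _).2
    · have : digitR x (Nat.pair m (t + 1)) = 0 := by
        simp only [dig, decide_eq_false_iff_not] at ht
        simp [digitR, ht]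
      rw [this, zero_div]; positivity
  have hd : digitR x (Nat.pair m 0) = if bit m x then 1 else 0 := by
    simp [digitR, bit, dig]
  rw [hu, hd]
  cases bit m x <;> simp <;> (try constructor) <;> (try linarith) <;> constructor <;> linarith

lemma sampleFin_eq {n : ℕ} (hn : 0 < n) (p : Fin n → ℝ) (u : ℝ) (i : Fin n)
    (h1 : u < ∑ z ∈ Finset.univ.filter fun z : Fin n => z ≤ i, p z)
    (h2 : ∀ y < i, ∑ z ∈ Finset.univ.filter (fun z : Fin n => z ≤ y), p z ≤ u) :
    sampleFin hn p u = i := by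
  unfold sampleFin
  have hi : i ∈ (Finset.univ.filter fun y : Fin n =>
    u < ∑ z ∈ Finset.univ.filter fun z : Fin n => z ≤ y, p z) := by simpa using h1
  simp only
  rw [dif_pos ⟨i, by simpa using h1⟩]
  apply le_antisymm
  · apply Finset.min'_le; simpa using h1
  · apply Finset.le_min'
    intro y hy
    by_contra! hlt
    have := h2 y hlt
    simp only [Finset.mem_filter, Finset.mem_univ, true_and] at hy
    linarith

lemma sampleOn_one {β : Type*} [Fintype β] [Nonempty β] [DecidableEq β] (y : β) {u : ℝ}
    (hu0 : 0 ≤ u) (hu : u < 1) : sampleOn (fun z => if z = y then (1 : ℝ) else 0) u = y := by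
  unfold sampleOn
  rw [Equiv.symm_apply_eq]
  have e : ∀ i, ((Fintype.equivFin β).symm i = y) ↔ i = Fintype.equivFin β y := fun i => by
    rw [Equiv.symm_apply_eq]
  simp only [e]
  apply sampleFin_eq
  · simpa [Finset.sum_ite_eq']
  · intro z hz
    simp [Finset.sum_ite_eq', not_le.2 hz, hu0]

lemma sampleOn_two_aux {β : Type*} [Fintype β] [Nonempty β] [DecidableEq β] (y y' : β)
    (p : β → ℝ) (hp : ∀ z, p z = (if z = y then (1 / 2 : ℝ) else 0) + if z = y' then 1 / 2 else 0)
    (hlt : Fintype.equivFin β y < Fintype.equivFin β y') {u : ℝ}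
    (hu0 : 0 ≤ u) (hu : u < 1) : sampleOn p u = if u < 1 / 2 then y else y' := by
  unfold sampleOn
  rw [Equiv.symm_apply_eq]
  have e : ∀ i y, ((Fintype.equivFin β).symm i = y) ↔ i = Fintype.equivFin β y := fun i y => by
    rw [Equiv.symm_apply_eq]
  simp only [hp, e]
  split_ifs with h
  · apply sampleFin_eq
    · simp only [Finset.sum_add_distrib, Finset.sum_ite_eq', Finset.mem_filter, Finset.mem_univ,
        true_and, le_refl, if_true, not_le.2 hlt, if_false]
      linarith
    · intro z hz
      simp [Finset.sum_add_distrib, Finset.sum_ite_eq', not_le.2 hz, not_le.2 (hz.trans hlt), hu0]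
  · apply sampleFin_eq
    · simp only [Finset.sum_add_distrib, Finset.sum_ite_eq', Finset.mem_filter, Finset.mem_univ,
        true_and, le_refl, if_true, hlt.le]
      linarith
    · intro z hz
      simp only [Finset.sum_add_distrib, Finset.sum_ite_eq', Finset.mem_filter, Finset.mem_univ,
        true_and, not_le.2 hz, if_false]
      split_ifs <;> linarith

lemma sampleOn_two {β : Type*} [Fintype β] [Nonempty β] [DecidableEq β] (y y' : β) (hne : y ≠ y')
    (p : β → ℝ) (hp : p = fun z => if z = y then (1 / 2 : ℝ) else if z = y' then 1 / 2 else 0) :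
    ∃ c : Bool, ∀ (u : ℝ) (b : Bool), 0 ≤ u → u < 1 → (u < 1 / 2 ↔ b = false) →
      sampleOn p u = if b = c then y else y' := by
  have hp' : ∀ z, p z = (if z = y then (1 / 2 : ℝ) else 0) + if z = y' then 1 / 2 else 0 := by
    intro z; rw [hp]; by_cases h : z = y
    · subst h; simp [hne]
    · simp [h]
  rcases lt_or_gt_of_ne ((Fintype.equivFin β).injective.ne hne) with h | h
  · refine ⟨false, fun u b h0 h1 hb => ?_⟩
    rw [sampleOn_two_aux y y' p hp' h h0 h1]
    simp only [hb]
  · refine ⟨true, fun u b h0 h1 hb => ?_⟩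
    rw [sampleOn_two_aux y' y p (fun z => by rw [hp' z, add_comm]) h h0 h1]
    simp only [hb]
    cases b <;> simp

/-- The transition rules, as functions of the bit. -/
structure Rules (c0 c1 c3 : Bool) (k : Fin 5) (a : Fin 2) (b : Bool) (y : Fin 5 × Fin 2) : Prop where
  r0 : k = 0 → y = if b = c0 then (1, 1) else (3, 0)
  r1a : k = 1 → a = 0 → y = if b = c1 then (2, 1) else (1, 0)
  r1b : k = 1 → a = 1 → y = (4, 0)
  r2a : k = 2 → a = 0 → y = (4, 0)
  r2b : k = 2 → a = 1 → y = (1, 0)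
  r3a : k = 3 → a = 0 → y = if b = c3 then (3, 1) else (3, 0)
  r3b : k = 3 → a = 1 → y = (4, 0)
  r4 : k = 4 → y = (4, 0)

lemma exists_rules : ∃ c0 c1 c3 : Bool, ∀ (k : Fin 5) (a : Fin 2) (u : ℝ) (b : Bool),
    0 ≤ u → u < 1 → (u < 1 / 2 ↔ b = false) → Rules c0 c1 c3 k a b (sampleOn (qex k a) u) := by
  obtain ⟨c0, h0⟩ := sampleOn_two ((1, 1) : Fin 5 × Fin 2) (3, 0) (by decide) _ rfl
  obtain ⟨c1, h1⟩ := sampleOn_two ((2, 1) : Fin 5 × Fin 2) (1, 0) (by decide) _ rfl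
  obtain ⟨c3, h3⟩ := sampleOn_two ((3, 1) : Fin 5 × Fin 2) (3, 0) (by decide) _ rfl
  refine ⟨c0, c1, c3, fun k a u b hu0 hu1 hb => ?_⟩
  have H4 := sampleOn_one ((4, 0) : Fin 5 × Fin 2) hu0 hu1
  have H1 := sampleOn_one ((1, 0) : Fin 5 × Fin 2) hu0 hu1
  constructor
  · rintro rfl
    rw [← h0 u b hu0 hu1 hb]; congr 1
  · rintro rfl rfl
    rw [← h1 u b hu0 hu1 hb]; congr 1
    funext y
    simp only [qex]
    by_cases e : y = (1, 0)
    · subst e; simp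
    · simp [e]
  · rintro rfl rfl
    exact Eq.trans (by congr 1) H4
  · rintro rfl rfl
    exact Eq.trans (by congr 1) H4
  · rintro rfl rfl
    exact Eq.trans (by congr 1) H1
  · rintro rfl rfl
    rw [← h3 u b hu0 hu1 hb]; congr 1
    funext y
    simp only [qex]
    by_cases e : y = (3, 0)
    · subst e; simp
    · simp [e]
  · rintro rfl rfl
    exact Eq.trans (by congr 1) H4
  · rintro rfl
    exact Eq.trans (by congr 1) H4

lemma pay_eq (σ : Γex.Strategy) : Γex.pay (diracBelief (0 : Fin 5)) σ =
    ∫ x in Set.Ico (0 : ℝ) 1, atTop.liminf (Γex.avg σ ((0 : Fin 5), x)) := by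
  have hv : vecMeasure (diracBelief (0 : Fin 5)) = Measure.dirac (0 : Fin 5) := by
    unfold vecMeasure diracBelief
    rw [Finset.sum_eq_single (0 : Fin 5)]
    · simp
    · intro b _ hb; simp [hb]
    · simp
  unfold POMDP.pay POMDP.envMeasure
  change ∫ ω, _ ∂((vecMeasure (diracBelief (0 : Fin 5))).prod _) = _
  rw [hv, Measure.dirac_prod]
  exact (measurableEmbedding_prodMk_left (0 : Fin 5)).integral_map _

/-- reference chain on branch 1: `true` for state 1, `false` for state 2 -/
def chain (c1 : Bool) (β : ℕ → Bool) : ℕ → Bool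
  | 0 => false
  | m + 1 => !(chain c1 β m) || !(β m == c1)

lemma chain_congr (c1 : Bool) {β β' : ℕ → Bool} (m : ℕ) (h : ∀ j < m, β j = β' j) :
    chain c1 β m = chain c1 β' m := by
  induction m with
  | zero => rfl
  | succ m ih =>
    simp only [chain]
    rw [ih fun j hj => h j (by omega), h m (by omega)]

lemma chain_lim (c1 : Bool) (β : ℕ → Bool)
    (h1 : Tendsto (fun n : ℕ =>
      (∑ i ∈ Finset.range n, if β i = c1 then (1 : ℝ) else 0) / n) atTop (nhds (1 / 2)))
    (h2 : Tendsto (fun n : ℕ =>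
      (∑ i ∈ Finset.range n, if β i = (if chain c1 β i then c1 else !c1) then (1 : ℝ) else 0) / n)
      atTop (nhds (1 / 2))) :
    Tendsto (fun n : ℕ => (1 / n : ℝ) *
      ∑ i ∈ Finset.range n, if chain c1 β i then (1 : ℝ) else 0) atTop (nhds (2 / 3)) := by
  have key : ∀ n : ℕ, 3 / 2 * (∑ i ∈ Finset.range n, if chain c1 β i then (1 : ℝ) else 0)
      = 3 / 2 * n - (∑ i ∈ Finset.range n, if β i = c1 then (1 : ℝ) else 0) / 2
        - (∑ i ∈ Finset.range n,
            if β i = (if chain c1 β i then c1 else !c1) then (1 : ℝ) else 0) / 2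
        - if chain c1 β n then 1 else 0 := by
    intro n
    induction n with
    | zero => simp [chain]
    | succ n ih =>
      simp only [Finset.sum_range_succ]
      rw [mul_add, ih]
      push_cast
      simp only [chain]
      generalize (∑ i ∈ Finset.range n, if β i = c1 then (1 : ℝ) else 0) = E1
      generalize (∑ i ∈ Finset.range n,
            if β i = (if chain c1 β i then c1 else !c1) then (1 : ℝ) else 0) = E2
      have hb : β n = c1 ∨ β n = !c1 := by cases β n <;> cases c1 <;> simp
      rcases Bool.eq_false_or_eq_true (chain c1 β n) with ha | ha <;>
      rcases hb with hb | hb <;> simp [ha, hb] <;> ring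
  have h3 : Tendsto (fun n : ℕ => (if chain c1 β n then (1 : ℝ) else 0) / n) atTop (nhds 0) := by
    refine squeeze_zero (fun n => ?_) (fun n => ?_) tendsto_one_div_atTop_nhds_zero_nat
    · split_ifs <;> positivity
    · gcongr; split_ifs <;> norm_num
  have h4 := ((((tendsto_const_nhds (x := (3 / 2 : ℝ))).sub (h1.div_const 2)).sub
    (h2.div_const 2)).sub h3).const_mul (2 / 3 : ℝ)
  rw [show (2 / 3 : ℝ) * (3 / 2 - 1 / 2 / 2 - 1 / 2 / 2 - 0) = 2 / 3 by norm_num] at h4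
  refine h4.congr' ?_
  filter_upwards [eventually_gt_atTop 0] with n hn
  have hn' : (n : ℝ) ≠ 0 := by positivity
  have k := key n
  field_simp
  linarith

/-- A run of the example POMDP driven by bits `β`. -/
structure Run (c0 c1 c3 : Bool) (σ : List (Fin 2 × Fin 2) → Fin 2) (β : ℕ → Bool)
    (st : ℕ → Fin 5) (hi : ℕ → List (Fin 2 × Fin 2)) : Prop where
  st0 : st 0 = 0
  hi0 : hi 0 = []
  step : ∀ m, ∃ y, Rules c0 c1 c3 (st m) (σ (hi m)) (β m) y ∧ st (m + 1) = y.1 ∧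
    hi (m + 1) = hi m ++ [(σ (hi m), y.2)]

/-- liminf average reward along a state sequence -/
noncomputable def lim (st : ℕ → Fin 5) : ℝ :=
  atTop.liminf fun n : ℕ => (1 / n : ℝ) *
    ∑ m ∈ Finset.range n, if st m = 1 ∨ st m = 3 then (1 : ℝ) else 0

lemma avg_bd (st : ℕ → Fin 5) (n : ℕ) : 0 ≤ (1 / n : ℝ) *
    (∑ m ∈ Finset.range n, if st m = 1 ∨ st m = 3 then (1 : ℝ) else 0) ∧ (1 / n : ℝ) *
    (∑ m ∈ Finset.range n, if st m = 1 ∨ st m = 3 then (1 : ℝ) else 0) ≤ 1 := by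
  have h : ∀ m, (0 : ℝ) ≤ (if st m = 1 ∨ st m = 3 then (1 : ℝ) else 0) := by
    intro m; split_ifs <;> norm_num
  constructor
  · exact mul_nonneg (by positivity) (Finset.sum_nonneg fun m _ => h m)
  · have h2 : (∑ m ∈ Finset.range n, if st m = 1 ∨ st m = 3 then (1 : ℝ) else 0) ≤ n := by
      calc _ ≤ ∑ m ∈ Finset.range n, (1 : ℝ) :=
            Finset.sum_le_sum fun m _ => by split_ifs <;> norm_num
        _ = n := by simp
    rw [one_div_mul_eq_div]
    exact div_le_one_of_le₀ h2 (by positivity)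

lemma lim_nonneg (st : ℕ → Fin 5) : 0 ≤ lim st := by
  unfold lim
  refine le_liminf_of_le ?_ (Eventually.of_forall fun n => (avg_bd st n).1)
  exact (isBoundedUnder_of ⟨1, fun n => (avg_bd st n).2⟩ : IsBoundedUnder (· ≤ ·) atTop _).isCoboundedUnder_ge

lemma lim_le_one (st : ℕ → Fin 5) : lim st ≤ 1 := by
  unfold lim
  refine liminf_le_of_frequently_le (Frequently.of_forall fun n => (avg_bd st n).2) ?_
  exact isBoundedUnder_of ⟨0, fun n => (avg_bd st n).1⟩

/-- if the rewards agree with `r` eventually then averages have the same limit -/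
lemma lim_eventually (st : ℕ → Fin 5) (N : ℕ) (v : ℝ)
    (h : ∀ m ≥ N, (if st m = 1 ∨ st m = 3 then (1 : ℝ) else 0) = v) : lim st = v := by
  unfold lim
  apply Tendsto.liminf_eq
  have h1 : Tendsto (fun m : ℕ => if st m = 1 ∨ st m = 3 then (1 : ℝ) else 0) atTop (nhds v) :=
    tendsto_const_nhds.congr' (by
      filter_upwards [eventually_ge_atTop N] with m hm
      exact (h m hm).symm)
  have := h1.cesaro
  simpa [one_div] using this

namespace Run
variable {c0 c1 c3 : Bool} {σ : List (Fin 2 × Fin 2) → Fin 2} {β : ℕ → Bool}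
    {st : ℕ → Fin 5} {hi : ℕ → List (Fin 2 × Fin 2)}

lemma dead (R : Run c0 c1 c3 σ β st hi) {m : ℕ} (h : st m = 4) : lim st = 0 := by
  apply lim_eventually st m
  intro n hn
  have : st n = 4 := by
    induction n, hn using Nat.le_induction with
    | base => exact h
    | succ n hn ih =>
      obtain ⟨y, hy, h1, -⟩ := R.step n
      rw [h1, hy.r4 ih]
  simp [this]

lemma br3 (R : Run c0 c1 c3 σ β st hi) (h0 : β 0 ≠ c0) (m : ℕ) :
    st (m + 1) = 3 ∨ st (m + 1) = 4 := by
  induction m with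
  | zero =>
    obtain ⟨y, hy, h1, -⟩ := R.step 0
    rw [h1, hy.r0 R.st0]; simp [h0]
  | succ m ih =>
    obtain ⟨y, hy, h1, -⟩ := R.step (m + 1)
    rw [h1]
    rcases ih with ih | ih
    · rcases (by omega : σ (hi (m + 1)) = 0 ∨ σ (hi (m + 1)) = 1) with h | h
      · rw [hy.r3a ih h]; split_ifs <;> simp
      · rw [hy.r3b ih h]; simp
    · rw [hy.r4 ih]; simp

lemma br1 (R : Run c0 c1 c3 σ β st hi) (h0 : β 0 = c0) (m : ℕ) :
    st (m + 1) = 4 ∨ st (m + 1) = if chain c1 β (m + 1) then 1 else 2 := by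
  induction m with
  | zero =>
    obtain ⟨y, hy, h1, -⟩ := R.step 0
    rw [h1, hy.r0 R.st0]; simp [h0, chain]
  | succ m ih =>
    obtain ⟨y, hy, h1, -⟩ := R.step (m + 1)
    rw [h1, chain]
    rcases ih with ih | ih
    · rw [hy.r4 ih]; simp
    · rcases (by omega : σ (hi (m + 1)) = 0 ∨ σ (hi (m + 1)) = 1) with h | h
      · cases hc : chain c1 β (m + 1)
        · rw [hy.r2a (by simpa [hc] using ih) h]; simp
        · rw [hy.r1a (by simpa [hc] using ih) h]
          by_cases hb : β (m + 1) = c1 <;> simp [hb]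
      · cases hc : chain c1 β (m + 1)
        · rw [hy.r2b (by simpa [hc] using ih) h]; simp
        · rw [hy.r1b (by simpa [hc] using ih) h]; simp

lemma lim_chain (R : Run c0 c1 c3 σ β st hi)
    (hc : Tendsto (fun n : ℕ => (1 / n : ℝ) *
      ∑ i ∈ Finset.range n, if chain c1 β i then (1 : ℝ) else 0) atTop (nhds (2 / 3)))
    (h : ∀ m, st (m + 1) = if chain c1 β (m + 1) then 1 else 2) : lim st = 2 / 3 := by
  unfold lim
  apply Tendsto.liminf_eq
  convert hc using 5 with n m hm
  cases m with
  | zero => simp [R.st0, chain]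
  | succ m => rw [h m]; cases chain c1 β (m + 1) <;> simp

lemma upper1 (R : Run c0 c1 c3 σ β st hi) (h0 : β 0 = c0)
    (hc : Tendsto (fun n : ℕ => (1 / n : ℝ) *
      ∑ i ∈ Finset.range n, if chain c1 β i then (1 : ℝ) else 0) atTop (nhds (2 / 3))) :
    lim st ≤ 2 / 3 := by
  by_cases h : ∃ m, st m = 4
  · obtain ⟨m, hm⟩ := h
    rw [R.dead hm]; norm_num
  · push Not at h
    exact (R.lim_chain hc fun m => (R.br1 h0 m).resolve_left (h _)).le

/-- finite recall kills branch 3 -/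
lemma kill3 (R : Run c0 c1 c3 σ β st hi) (h0 : β 0 ≠ c0) (M n : ℕ)
    (hw : ∀ i < M + 1, β (n + 1 + i) = if i < M then !c3 else c3)
    (hσ : ∀ h : List (Fin 2 × Fin 2), h.length = n + 1 →
      σ (h ++ (List.replicate M (0, 0) ++ [(0, 1)])) = 1) : lim st = 0 := by
  by_contra hne
  have h4 : ∀ m, st m ≠ 4 := fun m hm => hne (R.dead hm)
  have h3 : ∀ m, st (m + 1) = 3 := fun m => (R.br3 h0 m).resolve_right (h4 _)
  have hlen : ∀ m, (hi m).length = m := by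
    intro m
    induction m with
    | zero => simp [R.hi0]
    | succ m ih => obtain ⟨y, -, -, h⟩ := R.step m; rw [h]; simp [ih]
  have ha : ∀ m, σ (hi (m + 1)) = 0 := by
    intro m
    by_contra hh
    obtain ⟨y, hy, h1, -⟩ := R.step (m + 1)
    apply h4 (m + 2)
    rw [h1, hy.r3b (h3 m) (by omega)]
  have hs : ∀ m, hi (m + 2) = hi (m + 1) ++ [(0, if β (m + 1) = c3 then 1 else 0)] := by
    intro m
    obtain ⟨y, hy, -, h2⟩ := R.step (m + 1)
    rw [h2, hy.r3a (h3 m) (ha m), ha m]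
    split_ifs <;> rfl
  have hrep : ∀ i ≤ M, hi (n + 1 + i) = hi (n + 1) ++ List.replicate i (0, 0) := by
    intro i hiM
    induction i with
    | zero => simp
    | succ i ih =>
      have e := hs (n + i)
      have w := hw i (by omega)
      rw [if_pos (by omega)] at w
      rw [show n + i + 1 = n + 1 + i by ring, w, ih (by omega)] at e
      rw [show n + 1 + (i + 1) = n + i + 2 by ring, e, List.replicate_succ']
      simp
  have e := hs (n + M)
  have w := hw M (by omega)
  rw [if_neg (by omega)] at w
  rw [show n + M + 1 = n + 1 + M by ring, w, hrep M le_rfl] at e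
  have h1 := hσ (hi (n + 1)) (hlen _)
  have h2 := ha (n + M + 1)
  rw [show n + M + 1 + 1 = n + M + 2 by ring, e] at h2
  simp at h1 h2
  rw [h1] at h2
  simp at h2

/-- finite recall kills branch 1 -/
lemma kill1 (R : Run c0 c1 c3 σ β st hi) (h0 : β 0 = c0) (M n : ℕ)
    (hw : ∀ i < M + 2, β (n + 1 + i) = if i < M + 1 then !c1 else c1)
    (hσ : ∀ h : List (Fin 2 × Fin 2), h.length = n + 2 →
      σ (h ++ (List.replicate M (0, 0) ++ [(0, 1)])) = 0) : lim st = 0 := by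
  by_contra hne
  have h4 : ∀ m, st m ≠ 4 := fun m hm => hne (R.dead hm)
  have h3 : ∀ m, st (m + 1) = if chain c1 β (m + 1) then 1 else 2 :=
    fun m => (R.br1 h0 m).resolve_left (h4 _)
  have hlen : ∀ m, (hi m).length = m := by
    intro m
    induction m with
    | zero => simp [R.hi0]
    | succ m ih => obtain ⟨y, -, -, h⟩ := R.step m; rw [h]; simp [ih]
  have hs : ∀ m, chain c1 β (m + 1) = true →
      hi (m + 2) = hi (m + 1) ++ [(0, if β (m + 1) = c1 then 1 else 0)] := by
    intro m hm
    have h1 : st (m + 1) = 1 := by simpa [hm] using h3 m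
    obtain ⟨y, hy, hst, h2⟩ := R.step (m + 1)
    have ha : σ (hi (m + 1)) = 0 := by
      by_contra hh
      apply h4 (m + 2)
      rw [hst, hy.r1b h1 (by omega)]
    rw [h2, hy.r1a h1 ha, ha]
    split_ifs <;> rfl
  have hch : ∀ i ≤ M, chain c1 β (n + 2 + i) = true := by
    intro i hiM
    have := hw i (by omega)
    rw [if_pos (by omega)] at this
    rw [show n + 2 + i = n + 1 + i + 1 by ring, chain, this]
    cases c1 <;> simp
  have hrep : ∀ i ≤ M, hi (n + 2 + i) = hi (n + 2) ++ List.replicate i (0, 0) := by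
    intro i hiM
    induction i with
    | zero => simp
    | succ i ih =>
      have e := hs (n + 1 + i) (by
        rw [show n + 1 + i + 1 = n + 2 + i by ring]; exact hch i (by omega))
      have w := hw (i + 1) (by omega)
      rw [if_pos (by omega)] at w
      rw [show n + 1 + i + 1 = n + 2 + i by ring, show n + 2 + i = n + 1 + (i + 1) by ring, w,
        show n + 1 + (i + 1) = n + 2 + i by ring, ih (by omega)] at e
      rw [show n + 2 + (i + 1) = n + 1 + i + 2 by ring, e, List.replicate_succ']
      simp
  have hcM := hch M le_rfl
  have e := hs (n + 1 + M) (by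
        rw [show n + 1 + M + 1 = n + 2 + M by ring]; exact hcM)
  have w := hw (M + 1) (by omega)
  rw [if_neg (by omega)] at w
  rw [show n + 1 + M + 1 = n + 2 + M by ring, show n + 2 + M = n + 1 + (M + 1) by ring, w,
    show n + 1 + (M + 1) = n + 2 + M by ring, hrep M le_rfl] at e
  have h1 := hσ (hi (n + 2)) (hlen _)
  have hst2 : st (n + 1 + M + 2) = 2 := by
    have := h3 (n + 1 + M + 1)
    rw [chain, show n + 1 + M + 1 = n + 2 + M by ring, hcM,
      show n + 2 + M = n + 1 + (M + 1) by ring, w] at this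
    rw [show n + 1 + M + 2 = n + 1 + (M + 1) + 1 by ring]
    simpa using this
  obtain ⟨y, hy, hst, -⟩ := R.step (n + 1 + M + 2)
  apply h4 (n + 1 + M + 2 + 1)
  rw [hst, hy.r2a hst2 ?_]
  rw [e]
  simpa using h1

end Run

/-- the optimal strategy -/
def sopt : List (Fin 2 × Fin 2) → Fin 2
  | [] => 0
  | p :: t => if p.2 = 1 ∧ t.getLast?.map Prod.snd = some 1 then 1 else 0

namespace Run
variable {c0 c1 c3 : Bool} {β : ℕ → Bool}
    {st : ℕ → Fin 5} {hi : ℕ → List (Fin 2 × Fin 2)}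

lemma opt3 (R : Run c0 c1 c3 sopt β st hi) (h0 : β 0 ≠ c0) : lim st = 1 := by
  have key : ∀ m, st (m + 1) = 3 ∧ ∃ a t, hi (m + 1) = (a, 0) :: t := by
    intro m
    induction m with
    | zero =>
      obtain ⟨y, hy, h1, h2⟩ := R.step 0
      rw [h1, h2, R.hi0, hy.r0 R.st0]; simp [h0]
    | succ m ih =>
      obtain ⟨hst, a, t, ht⟩ := ih
      obtain ⟨y, hy, h1, h2⟩ := R.step (m + 1)
      have hs : sopt (hi (m + 1)) = 0 := by rw [ht]; simp [sopt]
      rw [h1, h2, hy.r3a hst hs, ht]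
      split_ifs <;> simp
  apply lim_eventually st 1
  intro m hm
  obtain ⟨k, rfl⟩ : ∃ k, m = k + 1 := ⟨m - 1, by omega⟩
  simp [(key k).1]

lemma opt1 (R : Run c0 c1 c3 sopt β st hi) (h0 : β 0 = c0) (m : ℕ) :
    st (m + 1) = if chain c1 β (m + 1) then 1 else 2 := by
  have key : ∀ m, st (m + 1) = (if chain c1 β (m + 1) then 1 else 2) ∧
      ∃ a t, hi (m + 1) = (a, 1) :: t ∧
        (t.getLast?.map Prod.snd = some 1 ↔ chain c1 β (m + 1) = false) := by
    intro m
    induction m with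
    | zero =>
      obtain ⟨y, hy, h1, h2⟩ := R.step 0
      rw [h1, h2, R.hi0, hy.r0 R.st0]; simp [h0, chain]
    | succ m ih =>
      obtain ⟨hst, a, t, ht, hl⟩ := ih
      obtain ⟨y, hy, h1, h2⟩ := R.step (m + 1)
      rw [h1, h2, ht, chain]
      cases hc : chain c1 β (m + 1)
      · have hs : sopt (hi (m + 1)) = 1 := by rw [ht]; simp [sopt, hl.2 hc]
        rw [hy.r2b (by simpa [hc] using hst) hs]
        simp
      · have hs : sopt (hi (m + 1)) = 0 := by
          rw [ht]; simp only [sopt]; rw [if_neg]; rintro ⟨-, h⟩; simp [hl.1 h] at hc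
        rw [hy.r1a (by simpa [hc] using hst) hs]
        rw [ht] at hs
        by_cases hb : β (m + 1) = c1 <;> simp [hb, hs]
  exact (key m).1

end Run

lemma avg_eq (σ : Γex.Strategy) (x : ℝ) : atTop.liminf (Γex.avg σ ((0 : Fin 5), x)) =
    lim (fun m => (Γex.traj σ ((0 : Fin 5), x) m).1) := rfl

lemma ae_chain (c1 : Bool) : ∀ᵐ x ∂(volume.restrict (Set.Ico (0 : ℝ) 1)),
    Tendsto (fun n : ℕ => (1 / n : ℝ) *
      ∑ i ∈ Finset.range n, if chain c1 (fun m => bit m x) i then (1 : ℝ) else 0)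
      atTop (nhds (2 / 3)) := by
  have h1 := fair_bit.slln (fun _ _ => c1) (fun _ _ _ _ _ h => h)
  have h2 := fair_bit.slln (fun i x => if chain c1 (fun m => bit m x) i then c1 else !c1) (by
    intro n v x y hxy hx
    have := chain_congr c1 (β := fun m => bit m x) (β' := fun m => bit m y) n hxy
    simpa [← this] using hx)
  filter_upwards [h1, h2] with x h1 h2
  exact chain_lim c1 _ h1 h2

lemma exists_run : ∃ c0 c1 c3 : Bool, ∀ (σ : Γex.Strategy) (x : ℝ), Good x →
    Run c0 c1 c3 σ (fun m => bit m x) (fun m => (Γex.traj σ ((0 : Fin 5), x) m).1)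
      (fun m => (Γex.traj σ ((0 : Fin 5), x) m).2) := by
  obtain ⟨c0, c1, c3, h⟩ := exists_rules
  refine ⟨c0, c1, c3, fun σ x hx => ⟨rfl, rfl, fun m => ?_⟩⟩
  obtain ⟨g0, g1, g2⟩ := hx m
  exact ⟨_, h (Γex.traj σ ((0 : Fin 5), x) m).1 (σ (Γex.traj σ ((0 : Fin 5), x) m).2) _ _ g0 g1 g2,
    rfl, rfl⟩

lemma int_two (c0 : Bool) (p q : ℝ) :
    Integrable (fun x => if bit 0 x = c0 then p else q) (volume.restrict (Set.Ico (0 : ℝ) 1)) ∧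
    ∫ x in Set.Ico (0 : ℝ) 1, (if bit 0 x = c0 then p else q) = (p + q) / 2 := by
  set μ := volume.restrict (Set.Ico (0 : ℝ) 1) with hμ
  have hm : ∀ v, MeasurableSet {x | bit 0 x = v} :=
    fun v => fair_bit.meas 0 (measurableSet_singleton v)
  have hh : ∀ v, μ {x | bit 0 x = v} = 2⁻¹ := by
    intro v
    have := fair_bit.half 0 Set.univ v (fun _ _ _ _ => trivial)
    rw [Set.univ_inter, measure_univ] at this
    rw [this]; simp
  have e : (fun x => if bit 0 x = c0 then p else q) =
      ({x | bit 0 x = c0}.indicator (fun _ => p)) + ({x | bit 0 x = !c0}.indicator (fun _ => q)) := by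
    funext x
    simp only [Pi.add_apply, Set.indicator, Set.mem_ofPred_eq]
    generalize bit 0 x = b
    cases b <;> cases c0 <;> simp
  have i1 : Integrable ({x | bit 0 x = c0}.indicator (fun _ => p)) μ :=
    (integrable_const p).indicator (hm _)
  have i2 : Integrable ({x | bit 0 x = !c0}.indicator (fun _ => q)) μ :=
    (integrable_const q).indicator (hm _)
  rw [e]
  refine ⟨i1.add i2, ?_⟩
  rw [integral_add' i1 i2, integral_indicator_const _ (hm _), integral_indicator_const _ (hm _)]
  simp only [Measure.real, hh]
  simp
  ring

lemma pay_le (σ : Γex.Strategy) (c0 : Bool) (p q : ℝ)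
    (h : ∀ᵐ x ∂(volume.restrict (Set.Ico (0 : ℝ) 1)),
      lim (fun m => (Γex.traj σ ((0 : Fin 5), x) m).1) ≤ if bit 0 x = c0 then p else q) :
    Γex.pay (diracBelief (0 : Fin 5)) σ ≤ (p + q) / 2 := by
  rw [pay_eq, ← (int_two c0 p q).2]
  exact integral_mono_of_nonneg (Eventually.of_forall fun x => lim_nonneg _) (int_two c0 p q).1 h

lemma upper (σ : Γex.Strategy) : Γex.pay (diracBelief (0 : Fin 5)) σ ≤ 5 / 6 := by
  obtain ⟨c0, c1, c3, hR⟩ := exists_run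
  refine (pay_le σ c0 (2 / 3) 1 ?_).trans (by norm_num)
  filter_upwards [ae_good, ae_chain c1] with x hg hc
  split_ifs with h
  · exact (hR σ x hg).upper1 h hc
  · exact lim_le_one _

lemma opt_val : Γex.pay (diracBelief (0 : Fin 5)) sopt = 5 / 6 := by
  obtain ⟨c0, c1, c3, hR⟩ := exists_run
  refine (pay_eq sopt).trans ?_
  rw [show (5 / 6 : ℝ) = (2 / 3 + 1) / 2 by norm_num, ← (int_two c0 (2 / 3) 1).2]
  apply integral_congr_ae
  filter_upwards [ae_good, ae_chain c1] with x hg hc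
  refine (avg_eq sopt x).trans ?_
  split_ifs with h
  · exact (hR sopt x hg).lim_chain hc ((hR sopt x hg).opt1 h)
  · exact (hR sopt x hg).opt3 h

lemma fin_recall (σ : Γex.Strategy) (hσ : Γex.FiniteRecall σ) :
    Γex.pay (diracBelief (0 : Fin 5)) σ ≤ 1 / 2 := by
  obtain ⟨c0, c1, c3, hR⟩ := exists_run
  obtain ⟨M', hM', hσ⟩ := hσ
  obtain ⟨M, rfl⟩ : ∃ M, M' = M + 1 := ⟨M' - 1, by omega⟩
  let σ' : List (Fin 2 × Fin 2) → Fin 2 := σ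
  let P : ℕ → Fin 2 := fun n =>
    σ' (List.replicate n (0, 0) ++ (List.replicate M (0, 0) ++ [(0, 1)]))
  have hP : ∀ n (h : List (Fin 2 × Fin 2)), h.length = n →
      σ' (h ++ (List.replicate M (0, 0) ++ [(0, 1)])) = P n := by
    intro n h hn
    have h1 : h.length = (List.replicate n ((0 : Fin 2), (0 : Fin 2))).length := by simpa using hn
    have h2 : (List.replicate M ((0 : Fin 2), (0 : Fin 2)) ++ [(0, 1)]).length = M + 1 := by simp
    exact hσ h (List.replicate n ((0 : Fin 2), (0 : Fin 2))) _ h1 h2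
  have hinf : {n | P (n + 1) = 1}.Infinite ∨ {n | P (n + 2) = 0}.Infinite := by
    by_contra! hcon
    obtain ⟨h1, h2⟩ := hcon
    obtain ⟨a, ha⟩ := h1.bddAbove
    obtain ⟨b, hb⟩ := h2.bddAbove
    rcases (by omega : P (a + b + 3) = 0 ∨ P (a + b + 3) = 1) with h | h
    · have := hb (show a + b + 1 ∈ {n | P (n + 2) = 0} from h); omega
    · have := ha (show a + b + 2 ∈ {n | P (n + 1) = 1} from h); omega
  rcases hinf with hT | hT
  · refine (pay_le σ c0 1 0 ?_).trans (by norm_num)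
    filter_upwards [ae_good, fair_bit.aeWord (fun i => if i < M then !c3 else c3) (M + 1)
      ((fun n => n + 1) '' {n | P (n + 1) = 1})
      (hT.image (add_left_injective 1).injOn)] with x hg hw
    obtain ⟨_, ⟨n, hn, rfl⟩, hw⟩ := hw
    split_ifs with h
    · exact lim_le_one _
    · exact ((hR σ x hg).kill3 h M n hw fun l hl => (hP _ l hl).trans hn).le
  · refine (pay_le σ c0 0 1 ?_).trans (by norm_num)
    filter_upwards [ae_good, fair_bit.aeWord (fun i => if i < M + 1 then !c1 else c1) (M + 2)
      ((fun n => n + 1) '' {n | P (n + 2) = 0})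
      (hT.image (add_left_injective 1).injOn)] with x hg hw
    obtain ⟨_, ⟨n, hn, rfl⟩, hw⟩ := hw
    split_ifs with h
    · exact ((hR σ x hg).kill1 h M n hw fun l hl => (hP _ l hl).trans hn).le
    · exact lim_le_one _

lemma val_eq : Γex.val (diracBelief (0 : Fin 5)) = 5 / 6 := by
  unfold POMDP.val
  apply le_antisymm
  · have : Nonempty Γex.Strategy := ⟨sopt⟩
    exact ciSup_le upper
  · refine opt_val.symm.le.trans ?_
    exact le_ciSup (f := fun σ : Γex.Strategy => Γex.pay (diracBelief (0 : Fin 5)) σ)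
      ⟨5 / 6, by rintro _ ⟨σ, rfl⟩; exact upper σ⟩ sopt

/-- In the example POMDP `Γex`, every finite-recall strategy has payoff at most `1/2`;
since the value from `k₀` is `5/6`, no finite-recall strategy is `ε`-optimal for
`ε < 1/3`. -/
theorem gammaEx_finiteRecall_bad :
    (∀ σ : Γex.Strategy, Γex.FiniteRecall σ →
      Γex.pay (diracBelief (0 : Fin 5)) σ ≤ 1 / 2) ∧
    Γex.val (diracBelief (0 : Fin 5)) = 5 / 6 ∧
    (∀ ε : ℝ, 0 < ε → ε < 1 / 3 →
      ∀ σ : Γex.Strategy, Γex.FiniteRecall σ →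
        ¬ (Γex.val (diracBelief (0 : Fin 5)) - ε ≤
            Γex.pay (diracBelief (0 : Fin 5)) σ)) := by

  refine ⟨fin_recall, val_eq, fun ε _ h2 σ hσ hcon => ?_⟩
  have := fin_recall σ hσ
  rw [val_eq] at hcon
  linarith

end PomdpPaper
end

section
/- For the blind MDP Γ_sw with initial belief p₁ = (1/4)δ_{k₁} + (3/4)δ_{k₂}: every constant strategy (playing the same action at every stage, which is the only possibility for a strategy whose action depends only on the support of the current belief) achieves long-run average payoff exactly 1/2, while the periodic strategy (b, a, b, a, …) achieves long-run average payoff 3/4, and v_∞(p₁) = 3/4. -/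
open MeasureTheory Filter

namespace PomdpPaper

/-- The example blind MDP `Γsw`: two states `k₁ = 0` and `k₂ = 1` that alternate
deterministically; action `a = 0` gives reward `1` in `k₁` and `0` in `k₂`, action
`b = 1` gives reward `0` in `k₁` and `1` in `k₂`. -/
noncomputable def Γsw : POMDP where
  nK := 2
  nA := 2
  nS := 1
  hK := by norm_num
  hA := by norm_num
  hS := by norm_num
  q := fun k _ y => if y.1 = k then 0 else 1
  q_nonneg := by
    intro k a y
    split_ifs <;> norm_num
  q_sum := by
    intro k a
    fin_cases k <;>
      simp [Fintype.sum_prod_type, Fin.sum_univ_two, Fin.sum_univ_one]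
  g := fun k act => if k = 0 then (if act = 0 then 1 else 0) else (if act = 0 then 0 else 1)
  g_nonneg := by
    intro k a
    split_ifs <;> norm_num
  g_le_one := by
    intro k a
    split_ifs <;> norm_num

/-- The initial belief `(1/4)·δ_{k₁} + (3/4)·δ_{k₂}`. -/
noncomputable def p1sw : Fin 2 → ℝ := fun k => if k = 0 then 1 / 4 else 3 / 4

lemma sampleFin_det {n : ℕ} (hn : 0 < n) (i0 : Fin n) (u : ℝ) (h0 : 0 ≤ u) (h1 : u < 1) :
    sampleFin hn (fun i => if i = i0 then 1 else 0) u = i0 := by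
  classical
  have key : ∀ y : Fin n, (u < ∑ z ∈ Finset.univ.filter (fun z : Fin n => z ≤ y),
      (if z = i0 then (1:ℝ) else 0)) ↔ i0 ≤ y := by
    intro y
    rw [Finset.sum_ite_eq']
    simp only [Finset.mem_filter, Finset.mem_univ, true_and]
    split_ifs with h
    · simp [h, h1]
    · simp [h, h0]
  unfold sampleFin
  simp only [key]
  have hm : i0 ∈ (Finset.univ.filter fun y : Fin n => i0 ≤ y) := by simp
  rw [dif_pos ⟨i0, by simp⟩]
  apply le_antisymm
  · exact Finset.min'_le _ _ (by simp)
  · apply Finset.le_min'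
    intro y hy
    simpa using hy

lemma sampleOn_det {β : Type*} [Fintype β] [Nonempty β] (p : β → ℝ) (y0 : β)
    (hp0 : p y0 = 1) (hp : ∀ y, y ≠ y0 → p y = 0) (u : ℝ) (h0 : 0 ≤ u) (h1 : u < 1) :
    sampleOn p u = y0 := by
  classical
  have : (fun i => p ((Fintype.equivFin β).symm i)) =
      fun i => if i = Fintype.equivFin β y0 then 1 else 0 := by
    funext i
    split_ifs with h
    · simp [h, hp0]
    · apply hp
      intro h'
      apply h
      simp [← h']
  unfold sampleOn
  rw [this, sampleFin_det _ _ _ h0 h1]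
  simp

lemma digitR_nonneg (x : ℝ) (i : ℕ) : 0 ≤ digitR x i := by
  unfold digitR; split_ifs <;> norm_num

lemma digitR_le (x : ℝ) (i : ℕ) : digitR x i ≤ 1 := by
  unfold digitR; split_ifs <;> norm_num

lemma unif_nonneg (x : ℝ) (m : ℕ) : 0 ≤ unif x m :=
  tsum_nonneg fun j => div_nonneg (digitR_nonneg _ _) (by positivity)

lemma hasSum_half : HasSum (fun j : ℕ => (1:ℝ) / 2 ^ (j + 1)) 1 := by
  have := hasSum_geometric_two' 1
  convert this using 2
  field_simp
  ring

lemma unif_lt_one (x : ℝ) (m : ℕ) (h : ∃ j, digitR x (Nat.pair m j) ≠ 1) : unif x m < 1 := by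
  obtain ⟨j, hj⟩ := h
  have hle : ∀ j, digitR x (Nat.pair m j) / 2 ^ (j + 1) ≤ (1:ℝ) / 2 ^ (j + 1) := fun j => by
    gcongr; exact digitR_le _ _
  have hs : Summable fun j => digitR x (Nat.pair m j) / 2 ^ (j + 1) :=
    Summable.of_nonneg_of_le (fun j => div_nonneg (digitR_nonneg _ _) (by positivity)) hle
      hasSum_half.summable
  rw [← hasSum_half.tsum_eq]
  apply Summable.tsum_lt_tsum (i := j) hle _ hs hasSum_half.summable
  have : digitR x (Nat.pair m j) < 1 := lt_of_le_of_ne (digitR_le _ _) hj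
  gcongr

/-- Seeds with all the digits of row `m` equal to one. -/
def badSet (m : ℕ) : Set ℝ := {x | x ∈ Set.Ico (0:ℝ) 1 ∧ ∀ j, ⌊x * 2 ^ (Nat.pair m j + 1)⌋ % 2 = 1}

lemma badSet_meas (m : ℕ) : MeasurableSet (badSet m) := by
  have : badSet m = Set.Ico (0:ℝ) 1 ∩ ⋂ j, (fun x : ℝ => ⌊x * 2 ^ (Nat.pair m j + 1)⌋) ⁻¹'
      {z | z % 2 = 1} := by
    ext x; simp [badSet]
  rw [this]
  refine measurableSet_Ico.inter (MeasurableSet.iInter fun j => ?_)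
  have : Measurable (fun x : ℝ => ⌊x * 2 ^ (Nat.pair m j + 1)⌋) :=
    Int.measurable_floor.comp (measurable_id.mul_const _)
  exact this (MeasurableSet.of_discrete)

lemma bad_aux {m i l : ℕ} (hil : Nat.pair m i < Nat.pair m l) {x y : ℝ} (hx : x ∈ badSet m)
    (hy : y ∈ badSet m)
    (h : y = x - 1 / 2 ^ (Nat.pair m i + 1) + 1 / 2 ^ (Nat.pair m l + 1)) : False := by
  have h1 := hx.2 l
  have h2 := hy.2 l
  obtain ⟨d, hd⟩ := Nat.exists_eq_add_of_lt hil
  have e : y * 2 ^ (Nat.pair m l + 1) = x * 2 ^ (Nat.pair m l + 1) + ((1 - 2 * 2 ^ d : ℤ) : ℝ) := by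
    rw [h, hd]
    push_cast
    field_simp
    ring
  rw [e, Int.floor_add_intCast] at h2
  omega

lemma badSet_null (m : ℕ) : volume (badSet m) = 0 := by
  by_contra hne
  let c : ℕ → ℝ := fun j => 1 / 2 ^ (Nat.pair m j + 1)
  let T : ℕ → Set ℝ := fun j => (fun x => x + c j) ⁻¹' badSet m
  have hT : ∀ j, volume (T j) = volume (badSet m) := fun j => measure_preimage_add_right _ _ _
  have hTm : ∀ j, MeasurableSet (T j) := fun j => (measurable_id.add_const _) (badSet_meas m)
  have hmono : ∀ i l, i < l → Nat.pair m i < Nat.pair m l := fun i l h => Nat.pair_lt_pair_right m h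
  have hd : Pairwise (Function.onFun Disjoint T) := by
    intro i l hil
    rw [Function.onFun, Set.disjoint_left]
    intro z hz1 hz2
    rcases lt_or_gt_of_ne hil with h | h
    · exact bad_aux (hmono _ _ h) hz1 hz2 (by simp only [c]; ring)
    · exact bad_aux (hmono _ _ h) hz2 hz1 (by simp only [c]; ring)
  have hsub : (⋃ j, T j) ⊆ Set.Icc (-1:ℝ) 1 := by
    apply Set.iUnion_subset
    intro j z hz
    have h := hz.1
    have h0 : 0 ≤ c j := by positivity
    have h1 : c j ≤ 1 := by
      simp only [c]
      rw [div_le_one (by positivity)]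
      exact one_le_pow₀ (by norm_num)
    simp only [Set.mem_Ico] at h
    constructor <;> linarith
  have hU : volume (⋃ j, T j) = ⊤ := by
    rw [measure_iUnion hd hTm]
    simp only [hT]
    exact ENNReal.tsum_const_eq_top_of_ne_zero hne
  have := measure_mono (μ := volume) hsub
  rw [hU] at this
  simp at this

lemma ae_unif_lt : ∀ᵐ x ∂(volume.restrict (Set.Ico (0 : ℝ) 1)), ∀ m, unif x m < 1 := by
  rw [ae_all_iff]
  intro m
  rw [ae_restrict_iff' measurableSet_Ico]
  have : ∀ᵐ x : ℝ, x ∉ badSet m := measure_eq_zero_iff_ae_notMem.mp (badSet_null m)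
  filter_upwards [this] with x hx hI
  apply unif_lt_one
  by_contra hcon
  push Not at hcon
  apply hx
  refine ⟨hI, fun j => ?_⟩
  have := hcon j
  unfold digitR at this
  by_contra h
  simp [h] at this

/-- The state after `m` switches. -/
def swSt (k : Fin 2) (m : ℕ) : Fin 2 := if m % 2 = 0 then k else 1 - k

/-- The deterministic history. -/
noncomputable def swH (σ : Γsw.Strategy) : ℕ → Γsw.Hist
  | 0 => []
  | m + 1 => swH σ m ++ ([(σ (swH σ m), (0 : Fin 1))] : List (Γsw.A × Γsw.S))

lemma swH_len (σ : Γsw.Strategy) (m : ℕ) : (swH σ m).length = m := by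
  induction m with
  | zero => rfl
  | succ m ih => simp [swH, ih]

lemma sw_sample (k a : Fin 2) (u : ℝ) (h0 : 0 ≤ u) (h1 : u < 1) :
    sampleOn (Γsw.q k a) u = ((1 - k, 0) : Fin 2 × Fin 1) := by
  apply sampleOn_det _ _ _ _ u h0 h1
  · show (if (1 - k : Fin 2) = k then (0:ℝ) else 1) = 1
    fin_cases k <;> simp
  · intro y
    change Fin 2 × Fin 1 at y
    intro hy
    show (if y.1 = k then (0:ℝ) else 1) = 0
    obtain ⟨y1, y2⟩ := y
    rw [if_pos]
    fin_cases y2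
    fin_cases y1 <;> fin_cases k <;> first | rfl | (exact absurd rfl hy)

lemma swSt_succ (k : Fin 2) (m : ℕ) : swSt k (m + 1) = 1 - swSt k m := by
  unfold swSt
  rcases Nat.mod_two_eq_zero_or_one m with h | h
  · have h2 : (m + 1) % 2 = 1 := by omega
    simp [h, h2]
  · have h2 : (m + 1) % 2 = 0 := by omega
    simp [h, h2]

lemma sw_traj (σ : Γsw.Strategy) (k : Fin 2) (x : ℝ) (hx : ∀ m, unif x m < 1) (m : ℕ) :
    Γsw.traj σ (k, x) m = (swSt k m, swH σ m) := by
  induction m with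
  | zero => rfl
  | succ m ih =>
    simp only [POMDP.traj, ih]
    have := sw_sample (swSt k m) (σ (swH σ m)) (unif x m) (unif_nonneg _ _) (hx m)
    rw [this]
    rw [swSt_succ]
    rfl

/-- The reward as a function of the initial state. -/
noncomputable def swR (α : ℕ → Fin 2) (k : Fin 2) (m : ℕ) : ℝ :=
  if swSt k m = α m then 1 else 0

noncomputable def swA (α : ℕ → Fin 2) (k : Fin 2) (n : ℕ) : ℝ :=
  (1 / n : ℝ) * ∑ m ∈ Finset.range n, swR α k m

lemma g_eq (k a : Fin 2) : Γsw.g k a = if k = a then 1 else 0 := by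
  show (if k = 0 then (if a = 0 then (1:ℝ) else 0) else (if a = 0 then 0 else 1)) = _
  fin_cases k <;> fin_cases a <;> simp

lemma sw_avg (σ : Γsw.Strategy) (k : Fin 2) (x : ℝ) (hx : ∀ m, unif x m < 1) :
    Γsw.avg σ (k, x) = swA (fun m => σ (swH σ m)) k := by
  funext n
  unfold POMDP.avg swA
  congr 1
  apply Finset.sum_congr rfl
  intro m _
  unfold POMDP.rew POMDP.act POMDP.state POMDP.hist
  rw [sw_traj σ k x hx]
  exact g_eq _ _

lemma sw_int (f : Fin 2 → ℝ) :
    ∫ ω : Fin 2 × ℝ, f ω.1 ∂((vecMeasure p1sw).prod (volume.restrict (Set.Ico (0 : ℝ) 1))) =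
      1 / 4 * f 0 + 3 / 4 * f 1 := by
  rw [integral_fun_fst]
  unfold vecMeasure
  rw [integral_finsetSum_measure]
  · simp [p1sw, Fin.sum_univ_two, integral_smul_measure]
    norm_num
  · intro i _
    exact (integrable_dirac (by simp)).smul_measure (by simp)

lemma sw_pay (σ : Γsw.Strategy) : Γsw.pay p1sw σ =
    1 / 4 * atTop.liminf (swA (fun m => σ (swH σ m)) 0) +
    3 / 4 * atTop.liminf (swA (fun m => σ (swH σ m)) 1) := by
  rw [← sw_int (fun k => atTop.liminf (swA (fun m => σ (swH σ m)) k))]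
  unfold POMDP.pay
  apply integral_congr_ae
  have h := (Measure.quasiMeasurePreserving_snd (μ := (vecMeasure p1sw : Measure (Fin 2)))
    (ν := volume.restrict (Set.Ico (0 : ℝ) 1))).ae ae_unif_lt
  change ∀ᵐ ω ∂((vecMeasure p1sw : Measure (Fin 2)).prod (volume.restrict (Set.Ico (0 : ℝ) 1))), _
  filter_upwards [h] with ω hω
  exact congrArg (fun s => atTop.liminf s) (sw_avg σ ω.1 ω.2 hω)

lemma sw_pay_blind (as : ℕ → Fin 2) : Γsw.pay p1sw (Γsw.blindStrat as) =
    1 / 4 * atTop.liminf (swA as 0) + 3 / 4 * atTop.liminf (swA as 1) := by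
  have : (fun m => (Γsw.blindStrat as) (swH (Γsw.blindStrat as) m)) = as := by
    funext m
    show as _ = _
    rw [swH_len]
  rw [sw_pay]
  erw [this]

lemma swR_add (α : ℕ → Fin 2) (m : ℕ) : swR α 0 m + swR α 1 m = 1 := by
  unfold swR swSt
  generalize α m = a
  rcases Nat.mod_two_eq_zero_or_one m with h | h <;> rw [h] <;> fin_cases a <;> simp

lemma swA_nonneg (α : ℕ → Fin 2) (k n) : 0 ≤ swA α k n := by
  unfold swA swR
  apply mul_nonneg (by positivity)
  apply Finset.sum_nonneg
  intro i _
  split_ifs <;> norm_num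

lemma swA_add (α : ℕ → Fin 2) (n : ℕ) (hn : 0 < n) : swA α 0 n + swA α 1 n = 1 := by
  unfold swA
  rw [← mul_add, ← Finset.sum_add_distrib]
  simp only [swR_add]
  have : (n:ℝ) ≠ 0 := by positivity
  simp [this]

lemma swA_le (α : ℕ → Fin 2) (k n) : swA α k n ≤ 1 := by
  rcases Nat.eq_zero_or_pos n with rfl | hn
  · simp [swA]
  · have := swA_add α n hn
    have h0 := swA_nonneg α 0 n
    have h1 := swA_nonneg α 1 n
    fin_cases k
    · show swA α 0 n ≤ 1
      linarith
    · show swA α 1 n ≤ 1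
      linarith

lemma sw_upper (α : ℕ → Fin 2) :
    1 / 4 * atTop.liminf (swA α 0) + 3 / 4 * atTop.liminf (swA α 1) ≤ 3 / 4 := by
  have hb : ∀ k, IsBoundedUnder (· ≥ ·) atTop (swA α k) := fun k =>
    isBoundedUnder_of ⟨0, swA_nonneg α k⟩
  have ha : ∀ k, IsBoundedUnder (· ≤ ·) atTop (swA α k) := fun k =>
    isBoundedUnder_of ⟨1, swA_le α k⟩
  have hadd : atTop.liminf (swA α 0) + atTop.liminf (swA α 1) ≤
      atTop.liminf (swA α 0 + swA α 1) :=
    le_liminf_add (hb 0) (ha 0) (hb 1) (ha 1).isCoboundedUnder_ge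
  have h1 : atTop.liminf (swA α 0 + swA α 1) = 1 := by
    apply Tendsto.liminf_eq
    apply tendsto_const_nhds.congr'
    filter_upwards [eventually_gt_atTop 0] with n hn
    exact (swA_add α n hn).symm
  have h2 : atTop.liminf (swA α 1) ≤ 1 := by
    have := liminf_le_liminf (f := atTop) (u := swA α 1) (v := fun _ => (1:ℝ))
      (Eventually.of_forall (swA_le α 1)) (hb 1)
      (isBoundedUnder_of (r := (· ≤ ·)) ⟨1, fun _ => le_refl _⟩).isCoboundedUnder_ge
    simpa using this
  linarith

lemma swA_const (c k : Fin 2) : atTop.liminf (swA (fun _ => c) k) = 1 / 2 := by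
  apply Tendsto.liminf_eq
  have hb : ∀ n : ℕ, |∑ m ∈ Finset.range n, swR (fun _ => c) k m - n / 2| ≤ 1 / 2 := by
    have hs : ∀ n : ℕ, ∑ m ∈ Finset.range (2 * n), swR (fun _ => c) k m = n := by
      intro n
      induction n with
      | zero => simp
      | succ n ih =>
        rw [show 2 * (n + 1) = 2 * n + 1 + 1 by ring, Finset.sum_range_succ, Finset.sum_range_succ,
          ih, add_assoc]
        push_cast
        congr 1
        have e : (2 * n + 1) % 2 = 1 := by omega
        unfold swR swSt
        simp only [e]
        fin_cases c <;> fin_cases k <;> simp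
    intro n
    rcases Nat.even_or_odd' n with ⟨j, rfl | rfl⟩
    · rw [hs]; push_cast; ring_nf; norm_num
    · rw [Finset.sum_range_succ, hs]
      unfold swR
      push_cast
      rw [abs_le]
      split_ifs <;> constructor <;> linarith
  rw [tendsto_iff_norm_sub_tendsto_zero]
  have hz : Tendsto (fun n : ℕ => (1 / 2 : ℝ) / n) atTop (nhds 0) :=
    tendsto_const_div_atTop_nhds_zero_nat _
  refine squeeze_zero' (Eventually.of_forall fun n => norm_nonneg _) ?_ hz
  filter_upwards [eventually_gt_atTop 0] with n hn
  have hn' : (0:ℝ) < n := by exact_mod_cast hn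
  have e : swA (fun _ => c) k n - 1 / 2 =
      (∑ m ∈ Finset.range n, swR (fun _ => c) k m - n / 2) / n := by
    unfold swA
    field_simp
  rw [e, norm_div, Real.norm_eq_abs, Real.norm_of_nonneg hn'.le]
  gcongr
  exact hb n

lemma swA_per0 : atTop.liminf (swA (fun m => if m % 2 = 0 then (1 : Fin 2) else 0) 0) = 0 := by
  have : swA (fun m => if m % 2 = 0 then (1 : Fin 2) else 0) 0 = fun _ => 0 := by
    funext n
    unfold swA
    rw [Finset.sum_eq_zero, mul_zero]
    intro m _
    unfold swR swSt
    split_ifs <;> simp_all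
  rw [this]; simp

lemma swA_per1 : atTop.liminf (swA (fun m => if m % 2 = 0 then (1 : Fin 2) else 0) 1) = 1 := by
  apply Tendsto.liminf_eq
  apply tendsto_const_nhds.congr'
  filter_upwards [eventually_gt_atTop 0] with n hn
  have h := swA_add (fun m => if m % 2 = 0 then (1 : Fin 2) else 0) n hn
  have : swA (fun m => if m % 2 = 0 then (1 : Fin 2) else 0) 0 n = 0 := by
    unfold swA
    rw [Finset.sum_eq_zero, mul_zero]
    intro m _
    unfold swR swSt
    split_ifs <;> simp_all
  linarith

/-- In `Γsw` with initial belief `(1/4, 3/4)`: every constant strategy has long-run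
average payoff `1/2`, the periodic strategy `(b, a, b, a, …)` has long-run average payoff
`3/4`, and the value is `3/4`. -/
theorem gammaSw_values :
    (∀ c : Fin 2, Γsw.pay p1sw (Γsw.blindStrat fun _ => c) = 1 / 2) ∧
    Γsw.pay p1sw (Γsw.blindStrat fun m => if m % 2 = 0 then (1 : Fin 2) else (0 : Fin 2)) = 3 / 4 ∧
    Γsw.val p1sw = 3 / 4 := by
  have hper : Γsw.pay p1sw
      (Γsw.blindStrat fun m => if m % 2 = 0 then (1 : Fin 2) else (0 : Fin 2)) = 3 / 4 := by
    have h := sw_pay_blind (fun m => if m % 2 = 0 then (1 : Fin 2) else 0)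
    rw [swA_per0, swA_per1] at h
    refine h.trans ?_
    norm_num
  have hub : ∀ σ, Γsw.pay p1sw σ ≤ 3 / 4 := fun σ => by
    rw [sw_pay]
    exact sw_upper _
  refine ⟨fun c => ?_, hper, ?_⟩
  · have h := sw_pay_blind (fun _ => c)
    rw [swA_const, swA_const] at h
    refine h.trans ?_
    norm_num
  · apply le_antisymm
    · exact ciSup_le hub
    · exact hper.symm.le.trans (le_ciSup (f := fun σ => Γsw.pay p1sw σ)
        ⟨3 / 4, by rintro _ ⟨σ, rfl⟩; exact hub σ⟩ _)

end PomdpPaper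
end
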